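/- arXiv:math/9905140 — 4 statements merged into one kernel-verified Lean document; each statement's English description precedes it below -/
import Mathlib

section
/- Let φ : ℝ² → ℝ² be a homeomorphism with coordinate functions φ₁, φ₂, and suppose that for every pair of coprime integers (a, b) there exists a pair of coprime integers (a', b') such that |a·φ₁(x,y) − b·φ₂(x,y)| = |a'·x − b'·y| for all (x,y) ∈ ℝ². Then there exist integers a₁, b₁, a₂, b₂ with a₁·b₂ − a₂·b₁ = 1 or a₁·b₂ − a₂·b₁ = −1, such that for every (x,y) ∈ ℝ², either φ(x,y) = (a₁·x + b₁·y, a₂·x + b₂·y) or φ(x,y) = (−(a₁·x + b₁·y), −(a₂·x + b₂·y)). In other words, φ is induced by an element of GL(2, ℤ) on the quotient ℝ²/±1. -/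
open Polynomial in
/-- If the square of a linear form agrees pointwise with the square of the sum or of the difference
of two linear forms, then it agrees everywhere with the same one of the two. -/
theorem exists_sign_of_sq_linear_form_eq (p q r s m n : ℝ)
    (h : ∀ x y : ℝ, (m * x - n * y) ^ 2 = (p * x - q * y + (r * x - s * y)) ^ 2 ∨
      (m * x - n * y) ^ 2 = (p * x - q * y - (r * x - s * y)) ^ 2) :
    ∃ ε : ℤ, ε ^ 2 = 1 ∧
      ∀ x y : ℝ, (m * x - n * y) ^ 2 = (p * x - q * y + ε * (r * x - s * y)) ^ 2 := by
  have key : ((C m - C n * X - (C (p + r) - C (q + s) * X)) *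
      (C m - C n * X + (C (p + r) - C (q + s) * X))) *
      ((C m - C n * X - (C (p - r) - C (q - s) * X)) *
      (C m - C n * X + (C (p - r) - C (q - s) * X))) = (0 : ℝ[X]) := by
    refine Polynomial.funext fun t ↦ ?_
    simp only [eval_mul, eval_sub, eval_add, eval_C, eval_X, eval_zero]
    rcases h 1 t with h | h
    · exact mul_eq_zero_of_left (by linear_combination h) _
    · exact mul_eq_zero_of_right _ (by linear_combination h)
  have sq_eq {a b : ℝ} (hk : (C m - C n * X - (C a - C b * X)) *
      (C m - C n * X + (C a - C b * X)) = 0) (x y : ℝ) :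
      (m * x - n * y) ^ 2 = (a * x - b * y) ^ 2 := by
    rw [sq_eq_sq_iff_eq_or_eq_neg]
    refine (mul_eq_zero.1 hk).imp (fun hk ↦ ?_) fun hk ↦ ?_ <;>
    · have h0 := congrArg (eval 0) hk
      have h1 := congrArg (eval 1) hk
      simp only [eval_mul, eval_sub, eval_add, eval_C, eval_X, eval_zero] at h0 h1
      linear_combination x * h0 + y * (h1 - h0)
  rcases mul_eq_zero.1 key with hk | hk
  · refine ⟨1, by norm_num, fun x y ↦ ?_⟩
    rw [sq_eq hk]; push_cast; ring
  · refine ⟨-1, by norm_num, fun x y ↦ ?_⟩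
    rw [sq_eq hk]; push_cast; ring

theorem eq_or_eq_neg_of_sq_eq_of_mul_eq {u v a b : ℝ} (hu : u ^ 2 = a ^ 2) (hv : v ^ 2 = b ^ 2)
    (huv : u * v = a * b) : (u, v) = (a, b) ∨ (u, v) = (-a, -b) := by
  simp only [Prod.mk.injEq]
  rcases eq_or_ne a 0 with rfl | ha
  · obtain rfl : u = 0 := by simpa using hu
    simpa using sq_eq_sq_iff_eq_or_eq_neg.1 hv
  · rcases sq_eq_sq_iff_eq_or_eq_neg.1 hu with rfl | rfl
    · exact .inl ⟨rfl, mul_left_cancel₀ ha huv⟩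
    · exact .inr ⟨rfl, mul_left_cancel₀ ha (by linear_combination -huv)⟩

/-- The row `(r, s)` completes the primitive row `(p, q)` to a unimodular matrix as soon as every
combination `k * (p, q) - (r, s)` is, up to signs of the entries, a primitive row. -/
theorem isUnit_det_of_forall_sub_isCoprime {p q r s : ℤ} (hpq : IsCoprime p q)
    (h : ∀ k : ℤ, ∃ a b : ℤ, IsCoprime a b ∧ (k * p - r) ^ 2 = a ^ 2 ∧ (k * q - s) ^ 2 = b ^ 2) :
    IsUnit (p * s - q * r) := by
  obtain ⟨α, β, hαβ⟩ := hpq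
  obtain ⟨a, b, hab, ha, hb⟩ := h (α * r + β * s)
  refine hab.isUnit_of_dvd' ?_ ?_
  · rw [← Int.pow_dvd_pow_iff two_ne_zero, ← ha, Int.pow_dvd_pow_iff two_ne_zero]
    exact ⟨β, by linear_combination r * hαβ⟩
  · rw [← Int.pow_dvd_pow_iff two_ne_zero, ← hb, Int.pow_dvd_pow_iff two_ne_zero]
    exact ⟨-α, by linear_combination s * hαβ⟩

/-- Key step for the once-punctured torus: a self-homeomorphism of ℝ² whose
coordinate functions turn coprime integer linear forms into coprime integer
linear forms (up to absolute value) is induced by an element of GL(2, ℤ),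
up to a global sign. -/
theorem stmt_0 (φ : Homeomorph (ℝ × ℝ) (ℝ × ℝ))
    (h : ∀ a b : ℤ, IsCoprime a b → ∃ a' b' : ℤ, IsCoprime a' b' ∧
      ∀ x y : ℝ,
        |(a : ℝ) * (φ (x, y)).1 - (b : ℝ) * (φ (x, y)).2| = |(a' : ℝ) * x - (b' : ℝ) * y|) :
    ∃ a₁ b₁ a₂ b₂ : ℤ,
      (a₁ * b₂ - a₂ * b₁ = 1 ∨ a₁ * b₂ - a₂ * b₁ = -1) ∧
      ∀ x y : ℝ,
        φ (x, y) = ((a₁ : ℝ) * x + (b₁ : ℝ) * y, (a₂ : ℝ) * x + (b₂ : ℝ) * y) ∨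
        φ (x, y) = (-((a₁ : ℝ) * x + (b₁ : ℝ) * y), -((a₂ : ℝ) * x + (b₂ : ℝ) * y)) := by
  have hsq (a b : ℤ) (hab : IsCoprime a b) : ∃ a' b' : ℤ, IsCoprime a' b' ∧ ∀ x y : ℝ,
      ((a : ℝ) * (φ (x, y)).1 - b * (φ (x, y)).2) ^ 2 = ((a' : ℝ) * x - b' * y) ^ 2 := by
    obtain ⟨a', b', hab', hφ⟩ := h a b hab
    exact ⟨a', b', hab', fun x y ↦ sq_eq_sq_iff_abs_eq_abs _ _ |>.2 (hφ x y)⟩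
  obtain ⟨p, q, hpq, hu⟩ := hsq 1 0 isCoprime_one_left
  obtain ⟨r, s, -, hv⟩ := hsq 0 1 isCoprime_one_right
  obtain ⟨m, n, -, hw⟩ := hsq 1 (-1) isCoprime_one_left
  push_cast at hu hv hw
  obtain ⟨ε, hε, hεw⟩ := exists_sign_of_sq_linear_form_eq p q r s m n fun x y ↦ by
    have hu := hu x y
    have hv := hv x y
    rw [← hw x y]
    have : ((φ (x, y)).1 * (φ (x, y)).2) ^ 2 = ((p * x - q * y) * (r * x - s * y)) ^ 2 := by
      rw [mul_pow, mul_pow, ← hu, ← hv]; ring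
    rcases sq_eq_sq_iff_eq_or_eq_neg.1 this with h | h
    · exact .inl (by linear_combination hu + hv + 2 * h)
    · exact .inr (by linear_combination hu + hv + 2 * h)
  have hε' : (ε : ℝ) ^ 2 = 1 := mod_cast hε
  have hv' (x y : ℝ) : (φ (x, y)).2 ^ 2 = (ε * (r * x - s * y)) ^ 2 := by
    linear_combination hv x y - (r * x - s * y) ^ 2 * hε'
  have huv (x y : ℝ) :
      (φ (x, y)).1 * (φ (x, y)).2 = (p * x - q * y) * (ε * (r * x - s * y)) := by
    linear_combination (hw x y + hεw x y - hu x y - hv' x y) / 2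
  have hdet : IsUnit (p * (ε * s) - q * (ε * r)) := by
    refine isUnit_det_of_forall_sub_isCoprime hpq fun k ↦ ?_
    obtain ⟨a, b, hab, hk⟩ := hsq k 1 isCoprime_one_right
    have hk' (x y : ℝ) :
        (k * (p * x - q * y) - ε * (r * x - s * y)) ^ 2 = (a * x - b * y) ^ 2 := by
      rw [← hk x y]
      push_cast
      linear_combination 2 * k * huv x y - k ^ 2 * hu x y - hv' x y
    refine ⟨a, b, hab, ?_, ?_⟩
    · have := hk' 1 0
      simp only [mul_one, mul_zero, sub_zero] at this
      exact_mod_cast this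
    · have := hk' 0 1
      rify
      linear_combination this
  refine ⟨p, -q, ε * r, -(ε * s), ?_, fun x y ↦ ?_⟩
  · rcases Int.isUnit_iff.1 hdet with h | h
    · exact .inr (by linear_combination -h)
    · exact .inl (by linear_combination -h)
  · convert eq_or_eq_neg_of_sq_eq_of_mul_eq (by linear_combination hu x y) (hv' x y) (huv x y)
      using 3 <;> push_cast <;> ring_nf
end

section
/- Let f : ℝ² → ℝ² be a continuous injective map with coordinate functions f₁, f₂, and suppose there are real numbers a₁, b₁, a₂, b₂ such that |f₁(x,y)| = |a₁·x + b₁·y| and |f₂(x,y)| = |a₂·x + b₂·y| for all (x,y) ∈ ℝ². Then a₁·b₂ − a₂·b₁ ≠ 0. -/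
/-- A continuous injective map ℝ² → ℝ² whose coordinate functions agree in
absolute value with linear forms has linearly independent linear forms. -/
theorem stmt_1 (f : ℝ × ℝ → ℝ × ℝ) (hf : Continuous f) (hinj : Function.Injective f)
    (a₁ b₁ a₂ b₂ : ℝ)
    (h1 : ∀ x y : ℝ, |(f (x, y)).1| = |a₁ * x + b₁ * y|)
    (h2 : ∀ x y : ℝ, |(f (x, y)).2| = |a₂ * x + b₂ * y|) :
    a₁ * b₂ - a₂ * b₁ ≠ 0 := by
  intro hdet
  have hzero (x y : ℝ) (hx : a₁ * x + b₁ * y = 0) (hy : a₂ * x + b₂ * y = 0) :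
      f (x, y) = 0 :=
    Prod.ext (abs_eq_zero.1 (by rw [h1, hx, abs_zero]))
      (abs_eq_zero.1 (by rw [h2, hy, abs_zero]))
  have hker (x y : ℝ) (hx : a₁ * x + b₁ * y = 0) (hy : a₂ * x + b₂ * y = 0) :
      x = 0 ∧ y = 0 :=
    Prod.mk.inj (hinj ((hzero x y hx hy).trans (hzero 0 0 (by simp) (by simp)).symm))
  obtain ⟨rfl, ha₁⟩ := hker b₁ (-a₁) (by ring) (by linarith)
  obtain ⟨rfl, ha₂⟩ := hker b₂ (-a₂) (by linarith) (by ring)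
  obtain rfl := neg_eq_zero.1 ha₁
  obtain rfl := neg_eq_zero.1 ha₂
  exact one_ne_zero (hker 1 0 (by simp) (by simp)).1
end

section
/- Let f, g : ℝ² → ℝ be continuous functions and let a₁, b₁, a₂, b₂ be real numbers with a₁·b₂ − a₂·b₁ ≠ 0, such that |f(x,y)| = |a₁·x + b₁·y| and |g(x,y)| = |a₂·x + b₂·y| for all (x,y) ∈ ℝ². Suppose moreover that there exist real numbers c, d with |f(x,y) + g(x,y)| = |c·x + d·y| for all (x,y), and real numbers c', d' with |f(x,y) − g(x,y)| = |c'·x + d'·y| for all (x,y). Then either f(x,y) = a₁·x + b₁·y for all (x,y) or f(x,y) = −(a₁·x + b₁·y) for all (x,y), and likewise either g(x,y) = a₂·x + b₂·y for all (x,y) or g(x,y) = −(a₂·x + b₂·y) for all (x,y). -/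
/-- A continuous function with the absolute value of a linear form has constant sign relative to
that form on the open half-space where the form is positive. -/
lemma exists_sign_of_abs_eq_abs_linear (h : ℝ × ℝ → ℝ) (hh : Continuous h) (a b : ℝ)
    (habs : ∀ x y : ℝ, |h (x, y)| = |a * x + b * y|) :
    ∃ s : ℝ, (s = 1 ∨ s = -1) ∧
      ∀ x y : ℝ, 0 < a * x + b * y → h (x, y) = s * (a * x + b * y) := by
  let S : Set (ℝ × ℝ) := {p | 0 < a * p.1 + b * p.2}
  have hconv : Convex ℝ S := by
    apply convex_halfSpace_gt
    constructor <;> intros <;> simp <;> ring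
  rcases hconv.isPreconnected.eq_or_eq_neg_of_sq_eq (f := h) (g := fun p ↦ a * p.1 + b * p.2)
      hh.continuousOn (by fun_prop) (fun p _ ↦ (sq_eq_sq_iff_abs_eq_abs _ _).2 (habs p.1 p.2))
      (fun hp ↦ ne_of_gt hp) with H | H
  · exact ⟨1, .inl rfl, fun x y hxy ↦ by simpa using H (x := (x, y)) hxy⟩
  · exact ⟨-1, .inr rfl, fun x y hxy ↦ by simpa using H (x := (x, y)) hxy⟩

/-- A continuous function with the absolute value of a linear form is given by that form up to
one sign on each of the two half-planes it cuts out. -/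
lemma exists_signs_of_abs_eq_abs_linear (h : ℝ × ℝ → ℝ) (hh : Continuous h) (a b : ℝ)
    (habs : ∀ x y : ℝ, |h (x, y)| = |a * x + b * y|) :
    ∃ s t : ℝ, (s = 1 ∨ s = -1) ∧ (t = 1 ∨ t = -1) ∧
      (∀ x y : ℝ, 0 ≤ a * x + b * y → h (x, y) = s * (a * x + b * y)) ∧
      (∀ x y : ℝ, a * x + b * y ≤ 0 → h (x, y) = t * (a * x + b * y)) := by
  obtain ⟨s, hs, hpos⟩ := exists_sign_of_abs_eq_abs_linear h hh a b habs
  obtain ⟨t, ht, hneg⟩ := exists_sign_of_abs_eq_abs_linear h hh (-a) (-b) fun x y ↦ by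
    rw [habs, ← abs_neg]
    congr 1
    ring
  have hzero : ∀ x y : ℝ, a * x + b * y = 0 → h (x, y) = 0 := fun x y hxy ↦ by
    simpa [hxy] using habs x y
  refine ⟨s, -t, hs, by rcases ht with rfl | rfl <;> simp, fun x y hxy ↦ ?_, fun x y hxy ↦ ?_⟩
  · rcases hxy.eq_or_lt with h0 | h0
    · rw [hzero x y h0.symm, ← h0, mul_zero]
    · exact hpos x y h0
  · rcases hxy.eq_or_lt with h0 | h0
    · rw [hzero x y h0, h0, mul_zero]
    · rw [hneg x y (by linarith)]
      ring

/-- If the signs on the two half-planes agree, the function is globally the linear form or its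
negative. -/
lemma eq_or_eq_neg_of_signs_eq {h : ℝ × ℝ → ℝ} {a b s : ℝ} (hs : s = 1 ∨ s = -1)
    (hpos : ∀ x y : ℝ, 0 ≤ a * x + b * y → h (x, y) = s * (a * x + b * y))
    (hneg : ∀ x y : ℝ, a * x + b * y ≤ 0 → h (x, y) = s * (a * x + b * y)) :
    (∀ x y : ℝ, h (x, y) = a * x + b * y) ∨ (∀ x y : ℝ, h (x, y) = -(a * x + b * y)) := by
  have hall : ∀ x y : ℝ, h (x, y) = s * (a * x + b * y) := fun x y ↦
    (le_total 0 (a * x + b * y)).elim (hpos x y) (hneg x y)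
  rcases hs with rfl | rfl
  · exact .inl fun x y ↦ by simpa using hall x y
  · exact .inr fun x y ↦ by simpa using hall x y


/-- Sign-rigidity: if two continuous functions on ℝ² agree in absolute value
with independent linear forms, and both their sum and difference also agree in
absolute value with linear forms, then each function is globally a linear form
with a constant sign. -/
theorem stmt_2 (f g : ℝ × ℝ → ℝ) (hf : Continuous f) (hg : Continuous g)
    (a₁ b₁ a₂ b₂ : ℝ) (hdet : a₁ * b₂ - a₂ * b₁ ≠ 0)
    (h1 : ∀ x y : ℝ, |f (x, y)| = |a₁ * x + b₁ * y|)
    (h2 : ∀ x y : ℝ, |g (x, y)| = |a₂ * x + b₂ * y|)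
    (hsum : ∃ c d : ℝ, ∀ x y : ℝ, |f (x, y) + g (x, y)| = |c * x + d * y|)
    (hdiff : ∃ c' d' : ℝ, ∀ x y : ℝ, |f (x, y) - g (x, y)| = |c' * x + d' * y|) :
    ((∀ x y : ℝ, f (x, y) = a₁ * x + b₁ * y) ∨
      (∀ x y : ℝ, f (x, y) = -(a₁ * x + b₁ * y))) ∧
    ((∀ x y : ℝ, g (x, y) = a₂ * x + b₂ * y) ∨
      (∀ x y : ℝ, g (x, y) = -(a₂ * x + b₂ * y))) := by
  obtain ⟨c, d, hsum⟩ := hsum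
  obtain ⟨c', d', hdiff⟩ := hdiff
  have hprod : ∀ x y : ℝ,
      4 * (f (x, y) * g (x, y)) = (c * x + d * y) ^ 2 - (c' * x + d' * y) ^ 2 := fun x y ↦ by
    rw [← sq_eq_sq_iff_abs_eq_abs _ _ |>.2 (hsum x y),
      ← sq_eq_sq_iff_abs_eq_abs _ _ |>.2 (hdiff x y)]
    ring
  obtain ⟨s, t, hs, ht, hfpos, hfneg⟩ := exists_signs_of_abs_eq_abs_linear f hf a₁ b₁ h1
  obtain ⟨s', t', hs', ht', hgpos, hgneg⟩ := exists_signs_of_abs_eq_abs_linear g hg a₂ b₂ h2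
  have hdual : ∀ u v : ℝ, ∃ x y : ℝ, a₁ * x + b₁ * y = u ∧ a₂ * x + b₂ * y = v :=
    fun u v ↦ ⟨(u * b₂ - v * b₁) / (a₁ * b₂ - a₂ * b₁), (a₁ * v - a₂ * u) / (a₁ * b₂ - a₂ * b₁),
      by rw [mul_div_assoc', mul_div_assoc', ← add_div, div_eq_iff hdet]; ring,
      by rw [mul_div_assoc', mul_div_assoc', ← add_div, div_eq_iff hdet]; ring⟩
  obtain ⟨p, q, hp₁, hp₂⟩ := hdual 1 0
  obtain ⟨m, n, hm₁, hm₂⟩ := hdual 0 1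
  have hP := hprod p q
  have hM := hprod m n
  rw [show g (p, q) = 0 by simpa [hp₂] using h2 p q] at hP
  rw [show f (m, n) = 0 by simpa [hm₁] using h1 m n] at hM
  have e₁ : a₁ * (p + m) + b₁ * (q + n) = 1 := by linarith
  have e₂ : a₂ * (p + m) + b₂ * (q + n) = 1 := by linarith
  have e₃ : a₁ * (-p - m) + b₁ * (-q - n) = -1 := by linarith
  have e₄ : a₂ * (-p - m) + b₂ * (-q - n) = -1 := by linarith
  have e₅ : a₁ * (p - m) + b₁ * (q - n) = 1 := by linarith
  have e₆ : a₂ * (p - m) + b₂ * (q - n) = -1 := by linarith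
  have hpp := hprod (p + m) (q + n)
  rw [hfpos _ _ (by linarith), hgpos _ _ (by linarith), e₁, e₂] at hpp
  have hnn := hprod (-p - m) (-q - n)
  rw [hfneg _ _ (by linarith), hgneg _ _ (by linarith), e₃, e₄] at hnn
  have hpn := hprod (p - m) (q - n)
  rw [hfpos _ _ (by linarith), hgneg _ _ (by linarith), e₅, e₆] at hpn
  have hst : s * s' = t * t' := by linarith
  have hst' : s * s' = s * t' := by linarith
  have hs0 : s ≠ 0 := by rcases hs with rfl | rfl <;> norm_num
  have ht0 : t' ≠ 0 := by rcases ht' with rfl | rfl <;> norm_num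
  obtain rfl : s' = t' := mul_left_cancel₀ hs0 hst'
  obtain rfl : s = t := mul_right_cancel₀ ht0 hst
  exact ⟨eq_or_eq_neg_of_signs_eq hs hfpos hfneg, eq_or_eq_neg_of_signs_eq hs' hgpos hgneg⟩
end

section
/- Let a₁, b₁, a₂, b₂ be integers with |a₁·b₂ − a₂·b₁| ≥ 2. Then there exist coprime integers a, b such that the two integers a·a₁ − b·a₂ and a·b₁ − b·b₂ are not coprime (they have a common divisor greater than 1, i.e. ¬IsCoprime (a·a₁ − b·a₂) (a·b₁ − b·b₂)). -/
/-- A vector that is nonzero modulo a prime `p` and is sent to zero modulo `p` by two linear forms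
can be replaced by a primitive vector with the same property. -/
theorem exists_isCoprime_dvd_of_prime {p : ℤ} (hp : Prime p) {x y a₁ b₁ a₂ b₂ : ℤ}
    (hxy : ¬ (p ∣ x ∧ p ∣ y)) (h₁ : p ∣ x * a₁ - y * a₂) (h₂ : p ∣ x * b₁ - y * b₂) :
    ∃ a b : ℤ, IsCoprime a b ∧ p ∣ a * a₁ - b * a₂ ∧ p ∣ a * b₁ - b * b₂ := by
  have hne : x ≠ 0 ∨ y ≠ 0 := by
    by_contra! h
    exact hxy (by simp [h.1, h.2])
  obtain ⟨g, a, b, hab, hx, hy⟩ : ∃ g a b : ℤ, IsCoprime a b ∧ x = g * a ∧ y = g * b := by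
    have hg : 0 < Int.gcd x y := Int.gcd_pos_iff.mpr hne
    refine ⟨Int.gcd x y, x / Int.gcd x y, y / Int.gcd x y, ?_, ?_, ?_⟩
    · exact Int.isCoprime_iff_gcd_eq_one.mpr (Int.gcd_ediv_gcd_ediv_gcd hg)
    · exact (Int.mul_ediv_cancel' (Int.gcd_dvd_left ..)).symm
    · exact (Int.mul_ediv_cancel' (Int.gcd_dvd_right ..)).symm
  subst hx hy
  have hpg : ¬ p ∣ g := fun h => hxy ⟨h.mul_right a, h.mul_right b⟩
  rw [mul_assoc, mul_assoc, ← mul_sub] at h₁ h₂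
  exact ⟨a, b, hab, (hp.dvd_or_dvd h₁).resolve_left hpg, (hp.dvd_or_dvd h₂).resolve_left hpg⟩

/-- If an integer 2×2 matrix has determinant of absolute value at least 2, then
some integer linear combination of its rows with coprime coefficients is a
non-primitive integer vector. -/
theorem stmt_3 (a₁ b₁ a₂ b₂ : ℤ) (hdet : 2 ≤ |a₁ * b₂ - a₂ * b₁|) :
    ∃ a b : ℤ, IsCoprime a b ∧ ¬ IsCoprime (a * a₁ - b * a₂) (a * b₁ - b * b₂) := by
  obtain ⟨p, hp, hpd⟩ : ∃ p : ℤ, Prime p ∧ p ∣ a₁ * b₂ - a₂ * b₁ := by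
    obtain ⟨q, hq, hqd⟩ := Nat.exists_prime_and_dvd
      (n := (a₁ * b₂ - a₂ * b₁).natAbs) (by rw [Int.abs_eq_natAbs] at hdet; omega)
    exact ⟨q, Nat.prime_iff_prime_int.mp hq, Int.natCast_dvd.mpr hqd⟩
  suffices h : ∃ a b : ℤ, IsCoprime a b ∧ p ∣ a * a₁ - b * a₂ ∧ p ∣ a * b₁ - b * b₂ by
    obtain ⟨a, b, hab, h₁, h₂⟩ := h
    exact ⟨a, b, hab, fun h => hp.not_isUnit (h.isUnit_of_dvd' h₁ h₂)⟩
  by_cases ha : p ∣ a₂ ∧ p ∣ a₁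
  · by_cases hb : p ∣ b₂ ∧ p ∣ b₁
    · exact ⟨1, 0, isCoprime_one_left, by simpa using ha.2, by simpa using hb.2⟩
    · refine exists_isCoprime_dvd_of_prime hp hb ?_ ⟨0, by ring⟩
      rwa [show b₂ * a₁ - b₁ * a₂ = a₁ * b₂ - a₂ * b₁ by ring]
  · refine exists_isCoprime_dvd_of_prime hp ha ⟨0, by ring⟩ ?_
    rwa [← dvd_neg, show -(a₂ * b₁ - a₁ * b₂) = a₁ * b₂ - a₂ * b₁ by ring]
end
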